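/- There exists a self-dual binary linear code C ⊆ F₂^{72} whose minimum nonzero Hamming weight is 12, which contains exactly 816 codewords of Hamming weight 12 and exactly 8640 codewords of Hamming weight 14 (the weight enumerator W_{72,1} with γ = 0 and β = 408). -/

import Mathlib

/-- A subspace `C` of `(ZMod 2)^ι` is self-dual if it equals its Euclidean dual. -/
def IsSelfDual {R : Type*} [CommRing R] {ι : Type*} [Fintype ι]
    (C : Submodule R (ι → R)) : Prop :=
  ∀ x, x ∈ C ↔ ∀ y ∈ C, ∑ i, x i * y i = 0

/-- The Hamming weight of a vector: the number of nonzero coordinates. -/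
def hamWt {ι : Type*} [Fintype ι] {R : Type*} [Zero R] [DecidableEq R] (v : ι → R) : ℕ :=
  (Finset.univ.filter fun i => v i ≠ 0).card

/-- The number with base `2 ^ 20` digits `l`, least significant digit first. -/
def pack : List ℕ → ℕ
  | [] => 0
  | x :: l => x + 2 ^ 20 * pack l

theorem pack_append (l m : List ℕ) : pack (l ++ m) = pack l + 2 ^ (20 * l.length) * pack m := by
  induction l with
  | nil => simp [pack]
  | cons x l ih => simp only [List.cons_append, pack, ih, List.length_cons]; ring

theorem pack_map_add {α : Type*} (f g : α → ℕ) (l : List α) :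
    pack (l.map fun x => f x + g x) = pack (l.map f) + pack (l.map g) := by
  induction l with
  | nil => simp [pack]
  | cons x l ih => simp only [List.map_cons, pack, ih]; ring

theorem pack_map_mul {α : Type*} (c : ℕ) (f : α → ℕ) (l : List α) :
    pack (l.map fun x => c * f x) = c * pack (l.map f) := by
  induction l with
  | nil => simp [pack]
  | cons x l ih => simp only [List.map_cons, pack, ih]; ring

theorem and_add_two_pow_mul {k x y : ℕ} (hx : x < 2 ^ k) (hy : y < 2 ^ k) (a b : ℕ) :
    (x + 2 ^ k * a) &&& (y + 2 ^ k * b) = (x &&& y) + 2 ^ k * (a &&& b) := by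
  refine Nat.eq_of_testBit_eq fun j => ?_
  rw [Nat.testBit_land, add_comm x, add_comm y, add_comm (x &&& y),
    Nat.testBit_two_pow_mul_add _ hx, Nat.testBit_two_pow_mul_add _ hy,
    Nat.testBit_two_pow_mul_add _ (lt_of_le_of_lt Nat.and_le_left hx)]
  split_ifs <;> simp

theorem pack_map_and {α : Type*} (f g : α → ℕ) (l : List α) (hf : ∀ x ∈ l, f x < 2 ^ 20)
    (hg : ∀ x ∈ l, g x < 2 ^ 20) :
    pack (l.map fun x => f x &&& g x) = pack (l.map f) &&& pack (l.map g) := by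
  induction l with
  | nil => simp [pack]
  | cons x l ih =>
    simp only [List.mem_cons, forall_eq_or_imp] at hf hg
    simp only [List.map_cons, pack, ih hf.2 hg.2, and_add_two_pow_mul hf.1 hg.1]

theorem pack_mod (l : List ℕ) : pack l % 1048575 = l.sum % 1048575 := by
  induction l with
  | nil => simp [pack]
  | cons x l ih => simp only [pack, List.sum_cons]; omega

/-- The number with `n` base `2 ^ 20` digits equal to `1`. -/
def ones (n : ℕ) : ℕ :=
  Nat.div (Nat.sub (Nat.shiftLeft 1 (Nat.mul 20 n)) 1) 1048575

theorem ones_length {α : Type*} (l : List α) : ones l.length = pack (l.map fun _ => 1) := by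
  have h : pack (l.map fun _ => 1) * 1048575 + 1 = 2 ^ (20 * l.length) := by
    induction l with
    | nil => simp [pack]
    | cons x l ih =>
      rw [List.length_cons, mul_add, pow_add, ← ih]
      simp only [List.map_cons, pack]; ring
  change (1 <<< (20 * l.length) - 1) / 1048575 = _
  rw [Nat.one_shiftLeft, ← h]
  omega

/-- The number of digits that are at most `t` among the `n` base `2 ^ 20` digits of `W`. -/
def countDigitsLE (t n W : ℕ) : ℕ :=
  Nat.mod (Nat.shiftRight (Nat.land (Nat.sub (Nat.mul (Nat.add 524288 t) (ones n)) W)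
    (Nat.mul 524288 (ones n))) 19) 1048575

theorem add_sub_and_two_pow {t x : ℕ} (ht : t < 524288) (hx : x ≤ 524288) :
    (524288 + t - x) &&& 524288 = 524288 * (decide (x ≤ t)).toNat := by
  rw [show 524288 = 2 ^ 19 by norm_num, Nat.and_two_pow, Nat.testBit_eq_decide_div_mod_eq, mul_comm]
  congr 3
  simp only [eq_iff_iff]
  omega

theorem countDigitsLE_pack {t : ℕ} (ht : t < 524288) {l : List ℕ} (hl : l.length < 1048575)
    (hx : ∀ x ∈ l, x ≤ 524288) :
    countDigitsLE t l.length (pack l) = l.countP (· ≤ t) := by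
  have hsub : (524288 + t) * ones l.length - pack l = pack (l.map fun x => 524288 + t - x) := by
    rw [ones_length, ← pack_map_mul]
    apply Nat.sub_eq_of_eq_add
    nth_rw 3 [← List.map_id l]
    rw [← pack_map_add]
    congr 1
    refine List.map_congr_left fun x h => ?_
    have := hx x h
    simp only [id]
    omega
  have hsum : (l.map fun x => (decide (x ≤ t)).toNat).sum = l.countP (· ≤ t) := by
    clear hl hx hsub
    induction l with
    | nil => rfl
    | cons x l ih =>
      rw [List.map_cons, List.sum_cons, ih, List.countP_cons]
      simp only [add_comm, Bool.toNat, Bool.cond_eq_ite]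
  change (((524288 + t) * ones l.length - pack l) &&& (524288 * ones l.length)) >>> 19 % 1048575 = _
  rw [hsub, ones_length, ← pack_map_mul, ← pack_map_and,
    List.map_congr_left (g := fun x => 524288 * (decide (x ≤ t)).toNat), pack_map_mul,
    Nat.shiftRight_eq_div_pow, show 2 ^ 19 = 524288 by norm_num,
    Nat.mul_div_cancel_left _ (by norm_num),
    pack_mod, hsum]
  · exact Nat.mod_eq_of_lt (lt_of_le_of_lt List.countP_le_length hl)
  · intro x h
    rw [mul_one]
    exact add_sub_and_two_pow ht (hx x h)
  · intro x _; omega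
  · intro x _; norm_num

/-- All sums (bitwise exclusive or) of `k` entries of a list. -/
def xorSums : ℕ → List ℕ → List ℕ
  | 0, _ => [0]
  | _ + 1, [] => []
  | k + 1, r :: rs => xorSums (k + 1) rs ++ (xorSums k rs).map (r ^^^ ·)

/-- The `j`-th binary digit of `a`. -/
def bitAt (a j : ℕ) : Bool :=
  Nat.beq (Nat.land (Nat.shiftRight a j) 1) 1

theorem bitAt_eq (a j : ℕ) : bitAt a j = a.testBit j := by
  change Nat.beq ((a >>> j) &&& 1) 1 = _
  rw [Nat.testBit, Nat.and_comm]
  rcases Nat.mod_two_eq_zero_or_one (a >>> j) with h | h <;>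
    simp [Nat.one_and_eq_mod_two, h, Nat.beq]

/-- The number of sublists of length `k`, in a form suited to evaluation by the kernel. -/
def width (R : List ℕ) : ℕ → ℕ :=
  List.rec (fun k => Nat.rec 1 (fun _ _ => 0) k)
    (fun _ _ ih k => Nat.rec 1 (fun k' _ => Nat.add (ih (Nat.succ k')) (ih k')) k) R

theorem width_eq : ∀ (R : List ℕ) (k : ℕ), width R k = (xorSums k R).length
  | [], 0 | [], _ + 1 | _ :: _, 0 => rfl
  | r :: R, k + 1 => by
    change width R (k + 1) + width R k = _
    rw [xorSums, List.length_append, List.length_map, width_eq, width_eq]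

theorem length_xorSums : ∀ (k : ℕ) (R : List ℕ), (xorSums k R).length = R.length.choose k
  | 0, R => by simp [xorSums]
  | _ + 1, [] => by simp [xorSums]
  | k + 1, r :: R => by
    rw [xorSums, List.length_append, List.length_map, length_xorSums, length_xorSums,
      List.length_cons, Nat.choose_succ_succ, add_comm]

/-- The digits of this number are the `j`-th bits, complemented if `f`, of the sums of `k` entries
of `R`. -/
def slice (j : ℕ) (R : List ℕ) : ℕ → Bool → ℕ :=
  List.rec (fun k f => Nat.rec (cond f 1 0) (fun _ _ => 0) k)
    (fun r rs ih k f => Nat.rec (cond f 1 0) (fun k' _ => Nat.add (ih (Nat.succ k') f)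
      (Nat.shiftLeft (cond (bitAt r j) (cond f (ih k' false) (ih k' true)) (ih k' f))
        (Nat.mul 20 (width rs (Nat.succ k'))))) k) R

theorem slice_eq (j : ℕ) : ∀ (R : List ℕ) (k : ℕ) (f : Bool),
    slice j R k f = pack ((xorSums k R).map fun x => (x.testBit j ^^ f).toNat)
  | [], 0, f | _ :: _, 0, f => by cases f <;> simp [xorSums, pack] <;> rfl
  | [], _ + 1, _ => rfl
  | r :: R, k + 1, f => by
    change slice j R (k + 1) f + (cond (bitAt r j) (cond f (slice j R k false) (slice j R k true))
      (slice j R k f)) <<< (20 * width R (k + 1)) = _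
    rw [xorSums, List.map_append, pack_append, Nat.shiftLeft_eq, List.length_map, ← width_eq,
      mul_comm, slice_eq, List.map_map]
    congr 2
    rw [bitAt_eq]
    simp only [slice_eq, Function.comp_def, Nat.testBit_xor]
    cases r.testBit j <;> cases f <;> simp

/-- The number of nonzero bits among the `n` lowest ones. -/
def bitWt (n x : ℕ) : ℕ := ∑ j ∈ Finset.range n, (x.testBit j).toNat

theorem bitWt_le (n x : ℕ) : bitWt n x ≤ n := by
  simpa [bitWt] using Finset.sum_le_card_nsmul (Finset.range n) _ 1
    fun j _ => Bool.toNat_le (x.testBit j)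

/-- The digits of this number are the weights of `a` plus the sums of `k` entries of `R`. -/
def packedWt (n : ℕ) (R : List ℕ) (k a : ℕ) : ℕ :=
  Nat.rec 0 (fun j ih => Nat.add ih (cond (bitAt a j) (slice j R k true) (slice j R k false))) n

theorem packedWt_eq (n : ℕ) (R : List ℕ) (k a : ℕ) :
    packedWt n R k a = pack ((xorSums k R).map fun x => bitWt n (x ^^^ a)) := by
  induction n with
  | zero =>
    simp only [bitWt, Finset.range_zero, Finset.sum_empty]
    have h := pack_map_mul 0 (fun _ => 0) (xorSums k R)
    exact ((zero_mul _).symm.trans h.symm : 0 = _)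
  | succ n ih =>
    change packedWt n R k a + cond (bitAt a n) (slice n R k true) (slice n R k false) = _
    simp only [bitWt, Finset.sum_range_succ, Nat.testBit_xor]
    rw [pack_map_add, ih, bitAt_eq]
    simp only [slice_eq, bitWt, Nat.testBit_xor]
    cases a.testBit n <;> rfl

/-- Summary of a list of weights: the number of entries `t + 1` in the lowest `30` bits, the number
of entries `t + 3` in the next ones, and the number of entries at most `t` in the highest ones. -/
def summary (t : ℕ) (l : List ℕ) : ℕ :=
  l.countP (· = t + 1) + (2 ^ 30 * l.countP (· = t + 3) + 2 ^ 60 * l.countP (· ≤ t))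

theorem summary_append (t : ℕ) (l m : List ℕ) :
    summary t (l ++ m) = summary t l + summary t m := by
  simp only [summary, List.countP_append]; ring

/-- `summary t` of the list of the `n` digits of `W`. -/
def summaryDigits (t n W : ℕ) : ℕ :=
  Nat.add (Nat.sub (countDigitsLE (Nat.add t 1) n W) (countDigitsLE t n W))
    (Nat.add (Nat.mul 1073741824
      (Nat.sub (countDigitsLE (Nat.add t 3) n W) (countDigitsLE (Nat.add t 2) n W)))
      (Nat.mul 1152921504606846976 (countDigitsLE t n W)))

theorem countP_le_succ (t : ℕ) (l : List ℕ) :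
    l.countP (· ≤ t + 1) = l.countP (· = t + 1) + l.countP (· ≤ t) := by
  induction l with
  | nil => rfl
  | cons x l ih =>
    simp only [List.countP_cons, ih, decide_eq_true_eq]
    split_ifs <;> omega

theorem summaryDigits_pack {t : ℕ} (ht : t + 3 < 524288) {l : List ℕ} (hl : l.length < 1048575)
    (hx : ∀ x ∈ l, x ≤ 524288) : summaryDigits t l.length (pack l) = summary t l := by
  change countDigitsLE (t + 1) l.length (pack l) - countDigitsLE t l.length (pack l) +
    (1073741824 * (countDigitsLE (t + 3) l.length (pack l) -
      countDigitsLE (t + 2) l.length (pack l)) +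
      1152921504606846976 * countDigitsLE t l.length (pack l)) = _
  rw [countDigitsLE_pack (by omega) hl hx, countDigitsLE_pack (by omega) hl hx,
    countDigitsLE_pack (by omega) hl hx, countDigitsLE_pack (by omega) hl hx,
    countP_le_succ t, countP_le_succ (t + 2), Nat.add_sub_cancel, Nat.add_sub_cancel]
  rfl

/-- `summary t` of the weights of `a` plus the sums of `k` entries of `P ++ R`, in a form suited to
evaluation by the kernel. -/
def tally (n t : ℕ) (R P : List ℕ) : ℕ → ℕ → ℕ :=
  List.rec (fun k a => summaryDigits t (width R k) (packedWt n R k a))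
    (fun r _ ih k a =>
      Nat.rec (ih 0 a) (fun k' _ => Nat.add (ih (Nat.succ k') a) (ih k' (Nat.xor a r))) k) P

theorem tally_eq {n t : ℕ} (hn : n ≤ 524288) (ht : t + 3 < 524288) (R : List ℕ) :
    ∀ (P : List ℕ) (k a : ℕ), (∀ i ≤ k, R.length.choose i < 1048575) →
      tally n t R P k a = summary t ((xorSums k (P ++ R)).map fun x => bitWt n (x ^^^ a))
  | [], k, a, h => by
    change summaryDigits t (width R k) (packedWt n R k a) = _
    rw [packedWt_eq, width_eq, ← List.length_map (fun x => bitWt n (x ^^^ a)),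
      summaryDigits_pack ht]
    · rfl
    · rw [List.length_map, length_xorSums]; exact h k le_rfl
    · simp only [List.mem_map]
      rintro _ ⟨x, -, rfl⟩
      exact (bitWt_le _ _).trans hn
  | r :: P, 0, a, h => by
    change tally n t R P 0 a = _
    rw [tally_eq hn ht R P 0 a h]
    simp [xorSums]
  | r :: P, k + 1, a, h => by
    change tally n t R P (k + 1) a + tally n t R P k (a ^^^ r) = _
    rw [tally_eq hn ht R P _ _ h, tally_eq hn ht R P k _ fun i hi => h i (by omega),
      List.cons_append, xorSums, List.map_append, summary_append, List.map_map]
    simp only [Function.comp_def]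
    congr 3
    funext x
    rw [Nat.xor_comm r, Nat.xor_assoc, Nat.xor_comm a]

open scoped Matrix

theorem xorSums_map {α : Type*} (g : α → ℕ) : ∀ (k : ℕ) (l : List α),
    xorSums k (l.map g) = (l.sublistsLen k).map fun s => (s.map g).foldr (· ^^^ ·) 0
  | 0, l => by simp [xorSums]
  | _ + 1, [] => by simp [xorSums]
  | k + 1, r :: l => by
    rw [List.map_cons, xorSums, List.sublistsLen_succ_cons, List.map_append, xorSums_map,
      xorSums_map, List.map_map, List.map_map]
    rfl

/-- The binary matrix whose rows are given by the binary digits of the entries of a list. -/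
def bitMatrix (n : ℕ) (L : List ℕ) : Matrix (Fin n) (Fin n) (ZMod 2) :=
  Matrix.of fun i j => ((L.getD i 0).testBit j).toNat

theorem cast_toNat_xor (a b : Bool) :
    ((a ^^ b).toNat : ZMod 2) = (a.toNat : ZMod 2) + (b.toNat : ZMod 2) := by
  cases a <;> cases b <;> decide

theorem sum_map_bitMatrix_apply {n : ℕ} (L : List ℕ) (s : List (Fin n)) (j : Fin n) :
    (s.map fun i => bitMatrix n L i j).sum =
      (((s.map fun i : Fin n => L.getD i 0).foldr (· ^^^ ·) 0).testBit j).toNat := by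
  induction s with
  | nil => simp
  | cons i s ih =>
    rw [List.map_cons, List.sum_cons, ih, List.map_cons, List.foldr_cons, Nat.testBit_xor,
      cast_toNat_xor]
    rfl

theorem hamWt_eq_bitWt {n : ℕ} {v : Fin n → ZMod 2} {x : ℕ}
    (h : ∀ j : Fin n, v j = (x.testBit j).toNat) : hamWt v = bitWt n x := by
  rw [hamWt, bitWt, Finset.card_filter, Finset.sum_range]
  refine Finset.sum_congr rfl fun j _ => ?_
  rw [h]
  cases x.testBit j <;> simp

/-- The number of vectors of weight `l` that `M` sends to a vector of weight `r`. -/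
noncomputable def weightCount {n : ℕ} (M : Matrix (Fin n) (Fin n) (ZMod 2)) (l r : ℕ) : ℕ :=
  Nat.card {a : Fin n → ZMod 2 // hamWt a = l ∧ hamWt (a ᵥ* M) = r}

theorem eq_one_of_ne_zero {a : ZMod 2} (h : a ≠ 0) : a = 1 := by
  revert a; decide

/-- A finset corresponds to its indicator function. -/
def indicatorEquiv (ι : Type*) [Fintype ι] [DecidableEq ι] : Finset ι ≃ (ι → ZMod 2) where
  toFun s i := if i ∈ s then 1 else 0
  invFun a := Finset.univ.filter fun i => a i ≠ 0
  left_inv s := by ext; simp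
  right_inv a := by
    ext i
    by_cases h : a i = 0
    · simp [h]
    · simp [eq_one_of_ne_zero h]

theorem hamWt_indicatorEquiv {ι : Type*} [Fintype ι] [DecidableEq ι] (s : Finset ι) :
    hamWt (indicatorEquiv ι s) = s.card := by
  simp [hamWt, indicatorEquiv]

theorem indicatorEquiv_vecMul {n : ℕ} (M : Matrix (Fin n) (Fin n) (ZMod 2)) (s : Finset (Fin n))
    (j : Fin n) : (indicatorEquiv (Fin n) s ᵥ* M) j = ∑ i ∈ s, M i j := by
  simp [indicatorEquiv, Matrix.vecMul, dotProduct]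

theorem weightCount_bitMatrix {n : ℕ} {L : List ℕ} (hL : L.length = n) (l r : ℕ) :
    weightCount (bitMatrix n L) l r = ((xorSums l L).map (bitWt n)).countP (· = r) := by
  have hmap : L = (List.finRange n).map fun i : Fin n => L.getD i 0 := by
    refine List.ext_getElem (by simp [hL]) fun i h₁ h₂ => ?_
    simp [h₁]
  let q (m : Multiset (Fin n)) : Prop :=
    hamWt (fun j => (m.map fun i => bitMatrix n L i j).sum) = r
  have hq (s : List (Fin n)) :
      q s ↔ bitWt n ((s.map fun i : Fin n => L.getD i 0).foldr (· ^^^ ·) 0) = r := by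
    change hamWt (fun j => (s.map fun i => bitMatrix n L i j).sum) = r ↔ _
    rw [hamWt_eq_bitWt fun j => sum_map_bitMatrix_apply L s j]
  classical
  calc
    weightCount (bitMatrix n L) l r =
        ((Finset.powersetCard l Finset.univ).filter fun s : Finset (Fin n) => q s.val).card := by
      rw [weightCount, ← Nat.card_congr ((indicatorEquiv (Fin n)).subtypeEquiv fun s => Iff.rfl)]
      refine Nat.subtype_card _ fun s => ?_
      rw [Finset.mem_filter, Finset.mem_powersetCard_univ, hamWt_indicatorEquiv,
        funext (indicatorEquiv_vecMul (bitMatrix n L) s)]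
      rfl
    _ = ((Finset.univ : Finset (Fin n)).val.powersetCard l).countP q := by
      rw [← Finset.map_val_val_powersetCard, Multiset.countP_map, Finset.card_def,
        Finset.filter_val]
    _ = _ := by
      rw [Fin.univ_def, Multiset.powersetCard_coe, Multiset.coe_countP, List.countP_map,
        List.countP_map]
      nth_rw 2 [hmap]
      rw [xorSums_map, List.countP_map]
      refine List.countP_congr fun s _ => ?_
      simpa using hq s

theorem weightCount_transpose {n : ℕ} {M : Matrix (Fin n) (Fin n) (ZMod 2)} (hM : M * Mᵀ = 1)
    (l r : ℕ) : weightCount Mᵀ l r = weightCount M r l := by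
  have hM' : Mᵀ * M = 1 := mul_eq_one_comm.mp hM
  refine Nat.card_congr
    ⟨fun a => ⟨a.1 ᵥ* Mᵀ, a.2.2, ?_⟩, fun a => ⟨a.1 ᵥ* M, a.2.2, ?_⟩, fun a => ?_, fun a => ?_⟩
  · rw [Matrix.vecMul_vecMul, hM', Matrix.vecMul_one]; exact a.2.1
  · rw [Matrix.vecMul_vecMul, hM, Matrix.vecMul_one]; exact a.2.1
  · simp [hM']
  · simp [hM]

/-- The code generated by the rows of the block matrix `(1 M)`. -/
def systematicCode {n : ℕ} (M : Matrix (Fin n) (Fin n) (ZMod 2)) :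
    Submodule (ZMod 2) (Fin (n + n) → ZMod 2) where
  carrier := {v | (fun j => v (Fin.natAdd n j)) = (fun i => v (Fin.castAdd n i)) ᵥ* M}
  zero_mem' := (Matrix.zero_vecMul M).symm
  add_mem' {v w} hv hw := by
    change (fun j => v (Fin.natAdd n j)) + (fun j => w (Fin.natAdd n j)) =
      ((fun i => v (Fin.castAdd n i)) + fun i => w (Fin.castAdd n i)) ᵥ* M
    rw [Matrix.add_vecMul, ← hv, ← hw]
  smul_mem' c v hv := by
    change c • (fun j => v (Fin.natAdd n j)) = (c • fun i => v (Fin.castAdd n i)) ᵥ* M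
    rw [Matrix.smul_vecMul, ← hv]

theorem append_mem_systematicCode {n : ℕ} {M : Matrix (Fin n) (Fin n) (ZMod 2)}
    {a b : Fin n → ZMod 2} : Fin.append a b ∈ systematicCode M ↔ b = a ᵥ* M := by
  change (fun j => Fin.append a b (Fin.natAdd n j)) =
    (fun i => Fin.append a b (Fin.castAdd n i)) ᵥ* M ↔ _
  simp only [Fin.append_left, Fin.append_right]

theorem exists_eq_append {α : Type*} {m n : ℕ} (v : Fin (m + n) → α) :
    ∃ (a : Fin m → α) (b : Fin n → α), v = Fin.append a b :=
  ⟨_, _, (Fin.append_castAdd_natAdd (f := v)).symm⟩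

theorem hamWt_append {m n : ℕ} (a : Fin m → ZMod 2) (b : Fin n → ZMod 2) :
    hamWt (Fin.append a b) = hamWt a + hamWt b := by
  simp [hamWt, Finset.card_filter, Fin.sum_univ_add]

theorem isSelfDual_systematicCode {n : ℕ} {M : Matrix (Fin n) (Fin n) (ZMod 2)}
    (hM : M * Mᵀ = 1) : IsSelfDual (systematicCode M) := by
  have hM' : Mᵀ * M = 1 := mul_eq_one_comm.mp hM
  have hsum (a b c d : Fin n → ZMod 2) :
      ∑ i, Fin.append a b i * Fin.append c d i = a ⬝ᵥ c + b ⬝ᵥ d := by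
    simp only [Fin.sum_univ_add, dotProduct, Fin.append_left, Fin.append_right]
  intro x
  obtain ⟨a, b, rfl⟩ := exists_eq_append x
  rw [append_mem_systematicCode]
  constructor
  · rintro rfl y hy
    obtain ⟨c, d, rfl⟩ := exists_eq_append y
    rw [append_mem_systematicCode] at hy
    rw [hsum, hy, ← Matrix.mulVec_transpose M c, Matrix.dotProduct_mulVec, Matrix.vecMul_vecMul, hM,
      Matrix.vecMul_one, CharTwo.add_self_eq_zero]
  · intro h
    have key : a + b ᵥ* Mᵀ = 0 := by
      refine dotProduct_eq_zero _ fun c => ?_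
      have := h (Fin.append c (c ᵥ* M)) (append_mem_systematicCode.mpr rfl)
      rw [hsum, ← Matrix.mulVec_transpose M c, Matrix.dotProduct_mulVec, ← add_dotProduct] at this
      exact this
    have hab : a = b ᵥ* Mᵀ := funext fun i => CharTwo.add_eq_zero.mp (congrFun key i)
    rw [hab, Matrix.vecMul_vecMul, hM', Matrix.vecMul_one]

theorem card_systematicCode_weight {n : ℕ} (M : Matrix (Fin n) (Fin n) (ZMod 2)) (w : ℕ) :
    Nat.card {v // v ∈ systematicCode M ∧ hamWt v = w} =
      ∑ l ∈ Finset.range (w + 1), weightCount M l (w - l) := by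
  classical
  let e : {v // v ∈ systematicCode M ∧ hamWt v = w} ≃
      {a : Fin n → ZMod 2 // hamWt a + hamWt (a ᵥ* M) = w} :=
    { toFun v := ⟨fun i => v.1 (Fin.castAdd n i), by
        obtain ⟨v, hv, hw⟩ := v
        obtain ⟨a, b, rfl⟩ := exists_eq_append v
        rw [append_mem_systematicCode] at hv
        rw [hamWt_append, hv] at hw
        simpa only [Fin.append_left] using hw⟩
      invFun a := ⟨Fin.append a.1 (a.1 ᵥ* M), append_mem_systematicCode.mpr rfl, by
        rw [hamWt_append, a.2]⟩
      left_inv v := by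
        obtain ⟨v, hv, hw⟩ := v
        obtain ⟨a, b, rfl⟩ := exists_eq_append v
        rw [append_mem_systematicCode] at hv
        simp only [Fin.append_left, hv]
      right_inv a := by simp }
  rw [Nat.card_congr e, Nat.subtype_card
    (Finset.univ.filter fun a : Fin n → ZMod 2 => hamWt a + hamWt (a ᵥ* M) = w) (by simp),
    Finset.card_eq_sum_card_fiberwise (f := hamWt) (t := Finset.range (w + 1))]
  · refine Finset.sum_congr rfl fun l hl => ?_
    rw [weightCount]
    refine (Nat.subtype_card _ fun a => ?_).symm
    rw [Finset.mem_range] at hl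
    simp only [Finset.mem_filter, Finset.mem_univ, true_and]
    omega
  · intro a ha
    rw [Finset.mem_coe, Finset.mem_filter] at ha
    rw [Finset.mem_coe, Finset.mem_range]
    omega

theorem weightCount_zero {n : ℕ} (M : Matrix (Fin n) (Fin n) (ZMod 2)) {r : ℕ} (hr : r ≠ 0) :
    weightCount M 0 r = 0 := by
  rw [weightCount, Nat.card_eq_zero]
  refine Or.inl ⟨fun ⟨a, ha, har⟩ => hr ?_⟩
  have : a = 0 := by
    funext i
    rw [hamWt, Finset.card_eq_zero, Finset.filter_eq_empty_iff] at ha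
    simpa using ha (Finset.mem_univ i)
  rw [← har, this, Matrix.zero_vecMul]
  simp [hamWt]

theorem weightCount_of_tally {n l t c d : ℕ} {P R : List ℕ} (hl : (P ++ R).length = n)
    (hn : n ≤ 524288) (ht : t + 3 < 524288) (hlen : ∀ i ≤ l, R.length.choose i < 1048575)
    (hc : c < 2 ^ 30) (hd : d < 2 ^ 30) (hchoose : n.choose l < 2 ^ 30)
    (h : tally n t R P l 0 = c + 2 ^ 30 * d) :
    weightCount (bitMatrix n (P ++ R)) l (t + 1) = c ∧
      weightCount (bitMatrix n (P ++ R)) l (t + 3) = d ∧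
      ∀ r ≤ t, weightCount (bitMatrix n (P ++ R)) l r = 0 := by
  simp only [weightCount_bitMatrix hl]
  rw [tally_eq hn ht R P l 0 hlen] at h
  simp only [Nat.xor_zero, summary] at h
  have hlength : ((xorSums l (P ++ R)).map (bitWt n)).length < 2 ^ 30 := by
    rwa [List.length_map, length_xorSums, hl]
  generalize (xorSums l (P ++ R)).map (bitWt n) = L at *
  have h₁ := List.countP_le_length (p := fun x => decide (x = t + 1)) (l := L)
  have h₂ := List.countP_le_length (p := fun x => decide (x = t + 3)) (l := L)
  have h₃ : L.countP (· ≤ t) = 0 := by omega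
  refine ⟨by omega, by omega, fun r hr => ?_⟩
  rw [← Nat.le_zero, ← h₃]
  refine List.countP_mono_left fun x _ hx => ?_
  simp only [decide_eq_true_eq] at hx ⊢
  omega

theorem weightCount_of_tally_36 {l t c d : ℕ} {P R : List ℕ} (hP : P.length = 12)
    (hR : R.length = 24) (hl : l ≤ 7) (ht : t ≤ 10) (hc : c < 2 ^ 30) (hd : d < 2 ^ 30)
    (h : tally 36 t R P l 0 = c + 2 ^ 30 * d) :
    weightCount (bitMatrix 36 (P ++ R)) l (t + 1) = c ∧
      weightCount (bitMatrix 36 (P ++ R)) l (t + 3) = d ∧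
      ∀ r ≤ t, weightCount (bitMatrix 36 (P ++ R)) l r = 0 := by
  refine weightCount_of_tally (by rw [List.length_append, hP, hR]) (by norm_num) (by omega) ?_
    hc hd ?_ h
  · intro i hi
    have hi' := hi.trans hl
    rw [hR]
    interval_cases i <;> norm_num [Nat.choose]
  · interval_cases l <;> norm_num [Nat.choose]

/-- The first 12 rows of the right half of the generator matrix, as binary expansions. -/
def rowsHead : List ℕ :=
  [3212579709, 6425159418, 12850318836, 25700637672, 51401275344, 34083336096, 68166410049,
    67613605506, 66507996420, 64296516105, 59873555475, 51027896358]

/-- The last 24 rows of the right half of the generator matrix, as binary expansions. -/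
def rowsTail : List ℕ :=
  [33336315981, 66672369819, 64625262903, 60531049071, 52342621407, 35966028222, 33705942945,
    67411623747, 66103770759, 63488064783, 58256652831, 47794091070, 26868705405, 53737148667,
    38754820599, 8790164463, 17580066783, 35159871423, 1600528254, 3200794365, 6401588730,
    12803177460, 25606354920, 51212709840]

/-- The first 12 columns of the right half of the generator matrix, as binary expansions. -/
def colsHead : List ℕ :=
  [3212703297, 6425406594, 12850551045, 25700839947, 51401417751, 34083358767, 68166455391,
    67613696190, 66507915645, 64296354555, 59873494518, 51027774444]

/-- The last 24 columns of the right half of the generator matrix, as binary expansions. -/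
def colsTail : List ℕ :=
  [33336072153, 66672144306, 64625074020, 60530933448, 52342652304, 35966090016, 1308090273,
    2615918403, 5231574663, 10462887183, 20925512223, 41851024446, 14982572157, 29964882171,
    59929502199, 51139527663, 33559578591, 67118895039, 65518575486, 62317674237, 55916133882,
    43113053172, 17506891752, 35013783504]

theorem tally_rows_1 : tally 36 10 rowsTail rowsHead 1 0 = 0 + 2 ^ 30 * 0 := by
  decide +kernel

theorem tally_rows_2 : tally 36 9 rowsTail rowsHead 2 0 = 36 + 2 ^ 30 * 0 := by
  decide +kernel

theorem tally_rows_3 : tally 36 8 rowsTail rowsHead 3 0 = 0 + 2 ^ 30 * 324 := by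
  decide +kernel

theorem tally_rows_4 : tally 36 7 rowsTail rowsHead 4 0 = 180 + 2 ^ 30 * 0 := by
  decide +kernel

theorem tally_rows_5 : tally 36 6 rowsTail rowsHead 5 0 = 0 + 2 ^ 30 * 1980 := by
  decide +kernel

theorem tally_rows_6 : tally 36 5 rowsTail rowsHead 6 0 = 384 + 2 ^ 30 * 0 := by
  decide +kernel

theorem tally_rows_7 : tally 36 4 rowsTail rowsHead 7 0 = 0 + 2 ^ 30 * 4032 := by
  decide +kernel

theorem tally_cols_1 : tally 36 10 colsTail colsHead 1 0 = 0 + 2 ^ 30 * 0 := by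
  decide +kernel

theorem tally_cols_2 : tally 36 9 colsTail colsHead 2 0 = 36 + 2 ^ 30 * 0 := by
  decide +kernel

theorem tally_cols_3 : tally 36 8 colsTail colsHead 3 0 = 0 + 2 ^ 30 * 324 := by
  decide +kernel

theorem tally_cols_4 : tally 36 7 colsTail colsHead 4 0 = 180 + 2 ^ 30 * 0 := by
  decide +kernel

theorem tally_cols_5 : tally 36 6 colsTail colsHead 5 0 = 0 + 2 ^ 30 * 1980 := by
  decide +kernel

theorem tally_cols_6 : tally 36 5 colsTail colsHead 6 0 = 384 + 2 ^ 30 * 0 := by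
  decide +kernel

theorem bitMatrix_cols :
    bitMatrix 36 (colsHead ++ colsTail) = (bitMatrix 36 (rowsHead ++ rowsTail))ᵀ := by
  have h : ∀ i j : Fin 36, ((colsHead ++ colsTail).getD i 0).testBit j =
      ((rowsHead ++ rowsTail).getD j 0).testBit i := by
    decide +kernel
  ext i j
  exact congrArg (fun b : Bool => (b.toNat : ZMod 2)) (h i j)

theorem bitMatrix_rows_mul_transpose :
    bitMatrix 36 (rowsHead ++ rowsTail) * (bitMatrix 36 (rowsHead ++ rowsTail))ᵀ = 1 := by
  have h : ∀ i j : Fin 36, ∑ k, bitMatrix 36 (rowsHead ++ rowsTail) i k *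
      bitMatrix 36 (rowsHead ++ rowsTail) j k = if i = j then 1 else 0 := by
    decide +kernel
  ext i j
  rw [Matrix.mul_apply, Matrix.one_apply]
  exact h i j

/-- There is a self-dual binary linear code of length 72 with minimum nonzero Hamming
weight 12, having exactly 816 codewords of weight 12 and exactly 8640 codewords of
weight 14 (weight enumerator `W_{72,1}` with γ = 0 and β = 408). -/
theorem exists_selfDual_code_72_gamma_0_beta_408 :
    ∃ C : Submodule (ZMod 2) (Fin 72 → ZMod 2),
      IsSelfDual C ∧
      IsLeast {k | ∃ v ∈ C, v ≠ 0 ∧ hamWt v = k} 12 ∧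
      Nat.card {v : Fin 72 → ZMod 2 // v ∈ C ∧ hamWt v = 12} = 816 ∧
      Nat.card {v : Fin 72 → ZMod 2 // v ∈ C ∧ hamWt v = 14} = 8640 := by
  have hM := bitMatrix_rows_mul_transpose
  have r1 := weightCount_of_tally_36 rfl rfl (by norm_num) (by norm_num) (by norm_num)
    (by norm_num) tally_rows_1
  have r2 := weightCount_of_tally_36 rfl rfl (by norm_num) (by norm_num) (by norm_num)
    (by norm_num) tally_rows_2
  have r3 := weightCount_of_tally_36 rfl rfl (by norm_num) (by norm_num) (by norm_num)
    (by norm_num) tally_rows_3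
  have r4 := weightCount_of_tally_36 rfl rfl (by norm_num) (by norm_num) (by norm_num)
    (by norm_num) tally_rows_4
  have r5 := weightCount_of_tally_36 rfl rfl (by norm_num) (by norm_num) (by norm_num)
    (by norm_num) tally_rows_5
  have r6 := weightCount_of_tally_36 rfl rfl (by norm_num) (by norm_num) (by norm_num)
    (by norm_num) tally_rows_6
  have r7 := weightCount_of_tally_36 rfl rfl (by norm_num) (by norm_num) (by norm_num)
    (by norm_num) tally_rows_7
  have c1 := weightCount_of_tally_36 rfl rfl (by norm_num) (by norm_num) (by norm_num)
    (by norm_num) tally_cols_1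
  have c2 := weightCount_of_tally_36 rfl rfl (by norm_num) (by norm_num) (by norm_num)
    (by norm_num) tally_cols_2
  have c3 := weightCount_of_tally_36 rfl rfl (by norm_num) (by norm_num) (by norm_num)
    (by norm_num) tally_cols_3
  have c4 := weightCount_of_tally_36 rfl rfl (by norm_num) (by norm_num) (by norm_num)
    (by norm_num) tally_cols_4
  have c5 := weightCount_of_tally_36 rfl rfl (by norm_num) (by norm_num) (by norm_num)
    (by norm_num) tally_cols_5
  have c6 := weightCount_of_tally_36 rfl rfl (by norm_num) (by norm_num) (by norm_num)
    (by norm_num) tally_cols_6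
  simp only [bitMatrix_cols, weightCount_transpose hM] at c1 c2 c3 c4 c5 c6
  generalize bitMatrix 36 (rowsHead ++ rowsTail) = M at *
  have hzero {l : ℕ} (hl : l ≠ 0) : weightCount M l 0 = 0 := by
    rw [← weightCount_transpose hM]
    exact weightCount_zero _ hl
  have hsmall (w : ℕ) (h₁ : w ≠ 0) (h₂ : w < 12) :
      Nat.card {v // v ∈ systematicCode M ∧ hamWt v = w} = 0 := by
    rw [card_systematicCode_weight, Finset.sum_eq_zero]
    intro l hl
    rw [Finset.mem_range] at hl
    rcases Nat.lt_or_ge l 8 with h | h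
    · interval_cases l
      · exact weightCount_zero _ (by omega)
      · exact r1.2.2 _ (by omega)
      · exact r2.2.2 _ (by omega)
      · exact r3.2.2 _ (by omega)
      · exact r4.2.2 _ (by omega)
      · exact r5.2.2 _ (by omega)
      · exact r6.2.2 _ (by omega)
      · exact r7.2.2 _ (by omega)
    · obtain ⟨r, hr⟩ : ∃ r, r = w - l := ⟨_, rfl⟩
      have hr' : r < 4 := by omega
      rw [← hr]
      interval_cases r
      · exact hzero (by omega)
      · exact c1.2.2 _ (by omega)
      · exact c2.2.2 _ (by omega)
      · exact c3.2.2 _ (by omega)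
  have h12 : Nat.card {v // v ∈ systematicCode M ∧ hamWt v = 12} = 816 := by
    rw [card_systematicCode_weight]
    simp [Finset.sum_range_succ, weightCount_zero, hzero, r1, r2, r3,
      r4, r5, r6, r7, c1, c2, c3, c4]
  have h14 : Nat.card {v // v ∈ systematicCode M ∧ hamWt v = 14} = 8640 := by
    rw [card_systematicCode_weight]
    simp [Finset.sum_range_succ, weightCount_zero, hzero, r1, r2, r3,
      r4, r5, r6, r7, c1, c2, c3, c4, c5, c6]
  refine ⟨systematicCode M, isSelfDual_systematicCode hM, ⟨?_, ?_⟩, h12, h14⟩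
  · have : Nat.card {v // v ∈ systematicCode M ∧ hamWt v = 12} ≠ 0 := by rw [h12]; norm_num
    obtain ⟨⟨⟨v, hv, hw⟩⟩, -⟩ := Nat.card_ne_zero.mp this
    refine ⟨v, hv, ?_, hw⟩
    rintro rfl
    simp [hamWt] at hw
  · rintro k ⟨v, hv, hv0, hw⟩
    by_contra! hk
    have hk0 : k ≠ 0 := by
      rintro rfl
      rw [hamWt, Finset.card_eq_zero, Finset.filter_eq_empty_iff] at hw
      exact hv0 (funext fun i => by simpa using hw (Finset.mem_univ i))
    have := hsmall k hk0 hk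
    rw [Finite.card_eq_zero_iff] at this
    exact this.false ⟨v, hv, hw⟩
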